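/- arXiv:1103.5478 — 2 statements merged into one kernel-verified Lean document; each statement's English description precedes it below -/
import Mathlib

section
/- Let X̃_1, X̃_2 be Exp(1) random variables, mutually independent and independent of X = (X_1,…,X_t). For every q ∈ (ℝ_+^*)^t, every x > 0 and every k, l ∈ {1,…,t}, the equality ∂P{⟨q,X⟩ ≤ x}/∂q_k = ∂P{⟨q,X⟩ ≤ x}/∂q_l holds if and only if (q_k − q_l) · f'_{⟨q,X⟩ + q_k X̃_1 + q_l X̃_2}(x) = 0. -/
open MeasureTheory ProbabilityTheory Finset

/-- The law of `(X_1, …, X_t)` where the `X_i` are i.i.d. `Exp(1)`. -/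
noncomputable def expLaw (t : ℕ) : Measure (Fin t → ℝ) :=
  Measure.pi fun _ => expMeasure 1

/-- The outage probability `P{⟨q,X⟩ ≤ x}`. -/
noncomputable def outage (t : ℕ) (x : ℝ) (q : Fin t → ℝ) : ℝ :=
  ((expLaw t) {v | ∑ i, q i * v i ≤ x}).toReal

/-- The joint law of `(X, X̃₁, X̃₂)`: all coordinates i.i.d. `Exp(1)`, mutually independent. -/
noncomputable def expLawExt2 (t : ℕ) : Measure ((Fin t → ℝ) × ℝ × ℝ) :=
  (expLaw t).prod ((expMeasure 1).prod (expMeasure 1))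

open scoped ENNReal

/-- The density of the sum of two independent exponential variables of mean `a`. -/
noncomputable def erlangTwoPDF (a u : ℝ) : ℝ :=
  max u 0 / a ^ 2 * Real.exp (-(max u 0 / a))

lemma continuous_erlangTwoPDF (a : ℝ) : Continuous (erlangTwoPDF a) := by
  unfold erlangTwoPDF
  fun_prop

lemma erlangTwoPDF_nonneg (a u : ℝ) : 0 ≤ erlangTwoPDF a u := by
  unfold erlangTwoPDF
  positivity

lemma erlangTwoPDF_pos {a u : ℝ} (ha : 0 < a) (hu : 0 < u) : 0 < erlangTwoPDF a u := by
  unfold erlangTwoPDF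
  have : 0 < max u 0 := lt_max_of_lt_left hu
  positivity

lemma erlangTwoPDF_le {a : ℝ} (ha : 0 < a) (u : ℝ) : erlangTwoPDF a u ≤ a⁻¹ := by
  unfold erlangTwoPDF
  set m := max u 0
  have h := Real.add_one_le_exp (m / a)
  rw [Real.exp_neg, ← div_eq_mul_inv, div_le_iff₀ (Real.exp_pos _)]
  have h2 : m / a ^ 2 = a⁻¹ * (m / a) := by field_simp
  rw [h2]
  gcongr
  linarith

lemma map_const_mul_expMeasure {a : ℝ} (ha : 0 < a) :
    (expMeasure 1).map (fun v => a * v) = expMeasure a⁻¹ := by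
  have : IsProbabilityMeasure (expMeasure 1) := isProbabilityMeasure_expMeasure one_pos
  have : IsProbabilityMeasure (expMeasure a⁻¹) :=
    isProbabilityMeasure_expMeasure (inv_pos.2 ha)
  have : IsProbabilityMeasure ((expMeasure 1).map (fun v => a * v)) :=
    Measure.isProbabilityMeasure_map (by fun_prop)
  refine Measure.eq_of_cdf _ _ ?_
  ext x
  rw [cdf_expMeasure_eq (inv_pos.2 ha), cdf_eq_real,
    map_measureReal_apply (by fun_prop) measurableSet_Iic]
  have h : (fun v => a * v) ⁻¹' Set.Iic x = Set.Iic (a⁻¹ * x) := by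
    ext v
    simp only [Set.mem_preimage, Set.mem_Iic]
    rw [le_inv_mul_iff₀ ha]
  rw [h, ← cdf_eq_real, cdf_expMeasure_eq one_pos]
  simp [ha]

lemma conv_withDensity_volume (ρ : Measure ℝ) [SFinite ρ] {f : ℝ → ℝ≥0∞} (hf : Measurable f) :
    Measure.conv ρ (volume.withDensity f) =
      volume.withDensity fun x => ∫⁻ z, f (x - z) ∂ρ := by
  have hm : Measurable fun p : ℝ × ℝ => f (p.1 - p.2) := by fun_prop
  refine Measure.ext_of_lintegral _ fun φ hφ => ?_
  have hf' : Measurable fun x => ∫⁻ z, f (x - z) ∂ρ := hm.lintegral_prod_right'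
  rw [Measure.lintegral_conv hφ, lintegral_withDensity_eq_lintegral_mul _ hf' hφ]
  simp only [Pi.mul_apply]
  have h1 : ∀ x, ∫⁻ y, φ (x + y) ∂(volume.withDensity f) = ∫⁻ y, f (y - x) * φ y := by
    intro x
    rw [lintegral_withDensity_eq_lintegral_mul _ hf (by fun_prop)]
    simp only [Pi.mul_apply]
    rw [← lintegral_add_left_eq_self (fun y => f (y - x) * φ y) x]
    simp
  simp only [h1]
  rw [lintegral_lintegral_swap (by fun_prop)]
  refine lintegral_congr fun y => ?_
  rw [lintegral_mul_const _ (by fun_prop)]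

lemma expMeasure_eq_withDensity (r : ℝ) :
    expMeasure r = volume.withDensity (exponentialPDF r) := rfl

lemma measurable_exponentialPDF (r : ℝ) : Measurable (exponentialPDF r) :=
  (measurable_exponentialPDFReal r).ennreal_ofReal

lemma expMeasure_conv_self {a : ℝ} (ha : 0 < a) :
    Measure.conv (expMeasure a⁻¹) (expMeasure a⁻¹) =
      volume.withDensity fun x => ENNReal.ofReal (erlangTwoPDF a x) := by
  have : IsProbabilityMeasure (expMeasure a⁻¹) :=
    isProbabilityMeasure_expMeasure (inv_pos.2 ha)
  have hm := measurable_exponentialPDF a⁻¹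
  conv_lhs => enter [2]; rw [expMeasure_eq_withDensity]
  rw [conv_withDensity_volume _ hm]
  congr 1
  ext x
  rw [expMeasure_eq_withDensity, lintegral_withDensity_eq_lintegral_mul _ hm (by fun_prop)]
  have h : ∀ z, (exponentialPDF a⁻¹ * fun z => exponentialPDF a⁻¹ (x - z)) z =
      (Set.Icc 0 x).indicator
        (fun _ => ENNReal.ofReal (a⁻¹ ^ 2 * Real.exp (-(a⁻¹ * x)))) z := by
    intro z
    simp only [Pi.mul_apply, exponentialPDF_eq, Set.indicator_apply, Set.mem_Icc, sub_nonneg]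
    by_cases h0 : 0 ≤ z
    · by_cases h1 : z ≤ x
      · simp only [h0, h1, if_true, and_self]
        rw [← ENNReal.ofReal_mul (by positivity)]
        congr 1
        rw [show -(a⁻¹ * x) = -(a⁻¹ * z) + -(a⁻¹ * (x - z)) by ring, Real.exp_add]
        ring
      · simp [h1]
    · simp [h0]
  rw [lintegral_congr h, lintegral_indicator measurableSet_Icc, setLIntegral_const,
    Real.volume_Icc, ← ENNReal.ofReal_mul (by positivity)]
  unfold erlangTwoPDF
  rcases le_total 0 x with hx | hx
  · rw [max_eq_left hx]
    congr 1
    field_simp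
    ring
  · rw [max_eq_right hx, ENNReal.ofReal_of_nonpos]
    · simp
    · exact mul_nonpos_of_nonneg_of_nonpos (by positivity) (by linarith)

/-- The convolution of `ρ` with the density `erlangTwoPDF a`. -/
noncomputable def erlangTwoConv (ρ : Measure ℝ) (a x : ℝ) : ℝ :=
  ∫ z, erlangTwoPDF a (x - z) ∂ρ

lemma erlangTwoConv_nonneg (ρ : Measure ℝ) (a x : ℝ) : 0 ≤ erlangTwoConv ρ a x :=
  integral_nonneg fun _ => erlangTwoPDF_nonneg _ _

section erlangTwoConv

variable (ρ : Measure ℝ) [IsProbabilityMeasure ρ] {a : ℝ}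

lemma integrable_erlangTwoPDF_sub (ha : 0 < a) (x : ℝ) :
    Integrable (fun z => erlangTwoPDF a (x - z)) ρ := by
  refine Integrable.of_bound
    (((continuous_erlangTwoPDF a).comp (by fun_prop)).aestronglyMeasurable) a⁻¹ ?_
  refine .of_forall fun z => ?_
  rw [Real.norm_of_nonneg (erlangTwoPDF_nonneg _ _)]
  exact erlangTwoPDF_le ha _

lemma continuous_erlangTwoConv (ha : 0 < a) : Continuous (erlangTwoConv ρ a) := by
  have hc := continuous_erlangTwoPDF a
  refine continuous_of_dominated (bound := fun _ => a⁻¹) (fun x => ?_) (fun x => ?_)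
    (integrable_const _) (.of_forall fun z => ?_)
  · exact (hc.comp (by fun_prop)).aestronglyMeasurable
  · refine .of_forall fun z => ?_
    rw [Real.norm_of_nonneg (erlangTwoPDF_nonneg _ _)]
    exact erlangTwoPDF_le ha _
  · exact hc.comp (by fun_prop)

lemma erlangTwoConv_le (ha : 0 < a) (x : ℝ) : erlangTwoConv ρ a x ≤ a⁻¹ := by
  calc erlangTwoConv ρ a x ≤ ∫ _, a⁻¹ ∂ρ :=
        integral_mono (integrable_erlangTwoPDF_sub ρ ha x) (integrable_const _)
          fun z => erlangTwoPDF_le ha _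
    _ = a⁻¹ := by simp

lemma erlangTwoConv_pos (ha : 0 < a) {x : ℝ} (h : 0 < ρ (Set.Iio x)) :
    0 < erlangTwoConv ρ a x := by
  unfold erlangTwoConv
  rw [integral_pos_iff_support_of_nonneg (fun _ => erlangTwoPDF_nonneg _ _)
    (integrable_erlangTwoPDF_sub ρ ha x)]
  refine h.trans_le (measure_mono fun z hz => ?_)
  exact (erlangTwoPDF_pos ha (sub_pos.2 hz)).ne'

lemma conv_expMeasure_conv_self (ha : 0 < a) :
    Measure.conv (Measure.conv ρ (expMeasure a⁻¹)) (expMeasure a⁻¹) =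
      volume.withDensity fun x => ENNReal.ofReal (erlangTwoConv ρ a x) := by
  have : IsProbabilityMeasure (expMeasure a⁻¹) :=
    isProbabilityMeasure_expMeasure (inv_pos.2 ha)
  rw [Measure.conv_assoc, expMeasure_conv_self ha,
    conv_withDensity_volume _ (continuous_erlangTwoPDF a).measurable.ennreal_ofReal]
  congr 1
  ext x
  exact (ofReal_integral_eq_lintegral_ofReal (integrable_erlangTwoPDF_sub ρ ha x)
    (.of_forall fun _ => erlangTwoPDF_nonneg _ _)).symm

end erlangTwoConv

/-- The convolution of the density `r` with the exponential density of rate `c`. -/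
noncomputable def expConv (c : ℝ) (r : ℝ → ℝ) (x : ℝ) : ℝ :=
  c * Real.exp (-(c * x)) * ∫ z in Set.Iic x, Real.exp (c * z) * r z

section expConv

variable {c C : ℝ} {r : ℝ → ℝ}

lemma integrableOn_exp_mul (hc : 0 < c) (hr : Continuous r) (h0 : ∀ x, 0 ≤ r x)
    (hC : ∀ x, r x ≤ C) (x : ℝ) :
    IntegrableOn (fun z => Real.exp (c * z) * r z) (Set.Iic x) := by
  refine Integrable.mul_bdd (c := C) (integrableOn_exp_mul_Iic hc x)
    hr.aestronglyMeasurable (.of_forall fun z => ?_)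
  rw [Real.norm_of_nonneg (h0 z)]
  exact hC z

lemma hasDerivAt_expConv (hc : 0 < c) (hr : Continuous r) (h0 : ∀ x, 0 ≤ r x)
    (hC : ∀ x, r x ≤ C) (x : ℝ) :
    HasDerivAt (expConv c r) (c * (r x - expConv c r x)) x := by
  have hcont : Continuous fun z => Real.exp (c * z) * r z := by fun_prop
  have h1 : HasDerivAt (fun y => ∫ z in Set.Iic y, Real.exp (c * z) * r z)
      (Real.exp (c * x) * r x) x := by
    have h2 := (intervalIntegral.integral_hasDerivAt_right (hcont.intervalIntegrable 0 x)
      (hcont.stronglyMeasurableAtFilter _ _) hcont.continuousAt).const_add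
      (∫ z in Set.Iic 0, Real.exp (c * z) * r z)
    refine h2.congr_of_eventuallyEq (.of_forall fun y => ?_)
    have := intervalIntegral.integral_Iic_sub_Iic (integrableOn_exp_mul hc hr h0 hC 0)
      (integrableOn_exp_mul hc hr h0 hC y)
    simp only
    linarith
  have h3 : HasDerivAt (fun y => c * Real.exp (-(c * y)))
      (c * (Real.exp (-(c * x)) * -(c * 1))) x :=
    ((((hasDerivAt_id x).const_mul c).neg).exp).const_mul c
  refine (h3.mul h1).congr_deriv ?_
  have h4 : Real.exp (-(c * x)) * Real.exp (c * x) = 1 := by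
    rw [← Real.exp_add]; simp
  unfold expConv
  linear_combination c * r x * h4

lemma expConv_nonneg (hc : 0 < c) (h0 : ∀ x, 0 ≤ r x) (x : ℝ) : 0 ≤ expConv c r x :=
  mul_nonneg (by positivity) (integral_nonneg fun z => mul_nonneg (Real.exp_nonneg _) (h0 z))

lemma expConv_pos (hc : 0 < c) (hr : Continuous r) (h0 : ∀ x, 0 ≤ r x)
    (hC : ∀ x, r x ≤ C) {x y : ℝ} (hyx : y < x) (hpos : ∀ z, y < z → 0 < r z) :
    0 < expConv c r x := by
  refine mul_pos (by positivity) ?_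
  rw [setIntegral_pos_iff_support_of_nonneg_ae
    (.of_forall fun z => mul_nonneg (Real.exp_nonneg _) (h0 z))
    (integrableOn_exp_mul hc hr h0 hC x)]
  refine lt_of_lt_of_le ?_ (measure_mono (s := Set.Ioc y x) fun z hz => ⟨?_, hz.2⟩)
  · simp [hyx]
  · exact (mul_pos (Real.exp_pos _) (hpos z hz.1)).ne'

lemma withDensity_conv_expMeasure (hc : 0 < c) (hr : Continuous r) (h0 : ∀ x, 0 ≤ r x)
    (hC : ∀ x, r x ≤ C) :
    Measure.conv (volume.withDensity fun x => ENNReal.ofReal (r x)) (expMeasure c) =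
      volume.withDensity fun x => ENNReal.ofReal (expConv c r x) := by
  have hm := measurable_exponentialPDF c
  have hr' : Measurable fun x => ENNReal.ofReal (r x) := hr.measurable.ennreal_ofReal
  rw [expMeasure_eq_withDensity, conv_withDensity_volume _ hm]
  congr 1
  ext x
  rw [lintegral_withDensity_eq_lintegral_mul _ hr' (by fun_prop)]
  have h : ∀ z, ((fun x => ENNReal.ofReal (r x)) * fun z => exponentialPDF c (x - z)) z =
      (Set.Iic x).indicator (fun z => ENNReal.ofReal
        (c * Real.exp (-(c * x)) * (Real.exp (c * z) * r z))) z := by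
    intro z
    simp only [Pi.mul_apply, exponentialPDF_eq, Set.indicator_apply, Set.mem_Iic, sub_nonneg]
    split_ifs with h1
    · rw [← ENNReal.ofReal_mul (h0 z)]
      congr 1
      rw [show -(c * (x - z)) = -(c * x) + c * z by ring, Real.exp_add]
      ring
    · simp
  rw [lintegral_congr h, lintegral_indicator measurableSet_Iic, expConv,
    ← integral_const_mul, ofReal_integral_eq_lintegral_ofReal]
  · exact (integrableOn_exp_mul hc hr h0 hC x).const_mul _
  · exact .of_forall fun z => mul_nonneg (by positivity)
      (mul_nonneg (Real.exp_nonneg _) (h0 z))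

end expConv

instance isProbabilityMeasure_expLaw (t : ℕ) : IsProbabilityMeasure (expLaw t) := by
  have : IsProbabilityMeasure (expMeasure 1) := isProbabilityMeasure_expMeasure one_pos
  unfold expLaw
  infer_instance

/-- The law of the weighted sum `∑ i ≠ k, q i * X i`. -/
noncomputable def restLaw {t : ℕ} (q : Fin t → ℝ) (k : Fin t) : Measure ℝ :=
  (expLaw t).map fun v => ∑ i ∈ univ.erase k, q i * v i

section restLaw

variable {t : ℕ} (q : Fin t → ℝ) (k : Fin t)

instance isProbabilityMeasure_restLaw : IsProbabilityMeasure (restLaw q k) :=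
  Measure.isProbabilityMeasure_map (Measurable.aemeasurable (by fun_prop))

lemma map_rest_add_eq_conv {s : ℝ} (hs : 0 < s) :
    (expLaw t).map (fun v => (∑ i ∈ univ.erase k, q i * v i) + s * v k) =
      Measure.conv (restLaw q k) (expMeasure s⁻¹) := by
  have hexp : IsProbabilityMeasure (expMeasure 1) := isProbabilityMeasure_expMeasure one_pos
  have hind : iIndepFun (fun (i : Fin t) (v : Fin t → ℝ) => Function.update q k s i * v i)
      (expLaw t) :=
    iIndepFun_pi (X := fun i y => Function.update q k s i * y) fun i => by fun_prop
  have h := hind.indepFun_finsetSum_of_notMem₀ (fun i => Measurable.aemeasurable (by fun_prop))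
    (notMem_erase k univ)
  have hsum : (∑ i ∈ univ.erase k, fun v : Fin t → ℝ => Function.update q k s i * v i) =
      fun v => ∑ i ∈ univ.erase k, q i * v i := by
    ext v
    rw [Finset.sum_apply]
    exact sum_congr rfl fun i hi => by rw [Function.update_of_ne (ne_of_mem_erase hi)]
  rw [hsum] at h
  simp only [Function.update_self] at h
  have h2 := h.map_add_eq_map_conv_map (by fun_prop) (by fun_prop)
  have h3 : (expLaw t).map (fun v => s * v k) = expMeasure s⁻¹ := by
    rw [← map_const_mul_expMeasure hs,
      ← (measurePreserving_eval (fun _ : Fin t => expMeasure 1) k).map_eq,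
      Measure.map_map (by fun_prop) (by fun_prop)]
    rfl
  rw [h3] at h2
  exact h2

lemma map_sum_eq_conv (hq : 0 < q k) :
    (expLaw t).map (fun v => ∑ i, q i * v i) =
      Measure.conv (restLaw q k) (expMeasure (q k)⁻¹) := by
  rw [← map_rest_add_eq_conv q k hq]
  congr 1
  ext v
  exact (sum_erase_add _ _ (mem_univ k)).symm

lemma conv_Iic_toReal (ρ : Measure ℝ) [IsProbabilityMeasure ρ] {s : ℝ} (hs : 0 < s) (x : ℝ) :
    (Measure.conv ρ (expMeasure s⁻¹) (Set.Iic x)).toReal =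
      ∫ z, (1 - Real.exp (-(max (x - z) 0 / s))) ∂ρ := by
  have : IsProbabilityMeasure (expMeasure s⁻¹) :=
    isProbabilityMeasure_expMeasure (inv_pos.2 hs)
  have hm : MeasurableSet ((fun p : ℝ × ℝ => p.1 + p.2) ⁻¹' Set.Iic x) :=
    measurableSet_Iic.preimage (by fun_prop)
  rw [Measure.conv, Measure.map_apply (by fun_prop) measurableSet_Iic, Measure.prod_apply hm,
    ← integral_toReal (measurable_measure_prodMk_left hm).aemeasurable
      (.of_forall fun _ => measure_lt_top _ _)]
  refine integral_congr_ae (.of_forall fun z => ?_)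
  have h : Prod.mk z ⁻¹' ((fun p : ℝ × ℝ => p.1 + p.2) ⁻¹' Set.Iic x) = Set.Iic (x - z) := by
    ext y
    simp [le_sub_iff_add_le']
  have h2 := cdf_expMeasure_eq (inv_pos.2 hs) (x - z)
  rw [cdf_eq_real, measureReal_def] at h2
  simp only [h, h2]
  split_ifs with h3
  · rw [max_eq_left h3, div_eq_inv_mul]
  · rw [max_eq_right (by linarith)]
    simp

lemma outage_update {s : ℝ} (hs : 0 < s) (x : ℝ) :
    outage t x (Function.update q k s) =
      ∫ z, (1 - Real.exp (-(max (x - z) 0 / s))) ∂restLaw q k := by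
  rw [← conv_Iic_toReal _ hs, ← map_rest_add_eq_conv q k hs,
    Measure.map_apply (by fun_prop) measurableSet_Iic, outage]
  congr 2
  ext v
  simp only [Set.mem_ofPred_eq, Set.mem_preimage, Set.mem_Iic]
  rw [← sum_erase_add _ _ (mem_univ k), Function.update_self]
  rw [sum_congr rfl fun i hi => by rw [Function.update_of_ne (ne_of_mem_erase hi)]]

lemma hasDerivAt_integral_exp (ρ : Measure ℝ) [IsProbabilityMeasure ρ] {a : ℝ} (ha : 0 < a)
    (x : ℝ) :
    HasDerivAt (fun s => ∫ z, (1 - Real.exp (-(max (x - z) 0 / s))) ∂ρ)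
      (-erlangTwoConv ρ a x) a := by
  unfold erlangTwoConv
  rw [← integral_neg]
  refine (hasDerivAt_integral_of_dominated_loc_of_deriv_le (bound := fun _ => (a / 2)⁻¹)
    (F' := fun s z => -erlangTwoPDF s (x - z)) (Ioi_mem_nhds (half_lt_self ha))
    (.of_forall fun s => ?_) ?_ ?_ (.of_forall fun z s hs => ?_) (integrable_const _)
    (.of_forall fun z s hs => ?_)).2
  · exact Continuous.aestronglyMeasurable (by fun_prop)
  · refine Integrable.of_bound (Continuous.aestronglyMeasurable (by fun_prop)) 1
      (.of_forall fun z => ?_)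
    have h1 : Real.exp (-(max (x - z) 0 / a)) ≤ 1 :=
      Real.exp_le_one_iff.2 (neg_nonpos.2 (by positivity))
    have h2 := Real.exp_pos (-(max (x - z) 0 / a))
    rw [Real.norm_of_nonneg (by linarith)]
    linarith
  · exact (integrable_erlangTwoPDF_sub ρ ha x).neg.aestronglyMeasurable
  · have hs' : a / 2 < s := hs
    have hs0 : 0 < s := by linarith
    rw [norm_neg, Real.norm_of_nonneg (erlangTwoPDF_nonneg _ _)]
    refine (erlangTwoPDF_le hs0 _).trans ?_
    gcongr
  · have hs' : a / 2 < s := hs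
    have hs0 : s ≠ 0 := by linarith
    have h := ((((hasDerivAt_inv hs0).const_mul (max (x - z) 0)).neg).exp).const_sub 1
    refine h.congr_deriv ?_
    unfold erlangTwoPDF
    simp only [div_eq_mul_inv, Pi.neg_apply]
    ring

lemma deriv_outage_update (hq : 0 < q k) (x : ℝ) :
    deriv (fun s => outage t x (Function.update q k s)) (q k) =
      -erlangTwoConv (restLaw q k) (q k) x := by
  refine ((hasDerivAt_integral_exp (restLaw q k) hq x).congr_of_eventuallyEq ?_).deriv
  filter_upwards [Ioi_mem_nhds hq] with s hs
  exact outage_update q k hs x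

lemma expMeasure_Iio_pos {δ : ℝ} (hδ : 0 < δ) : 0 < expMeasure 1 (Set.Iio δ) := by
  have : IsProbabilityMeasure (expMeasure 1) := isProbabilityMeasure_expMeasure one_pos
  have h : 0 < (expMeasure 1).real (Set.Iic (δ / 2)) := by
    rw [← cdf_eq_real, cdf_expMeasure_eq one_pos, if_pos (by linarith), sub_pos,
      Real.exp_lt_one_iff]
    linarith
  exact (ENNReal.toReal_pos_iff.1 h).1.trans_le
    (measure_mono (Set.Iic_subset_Iio.2 (by linarith)))

lemma restLaw_Iio_pos (hq : ∀ i, 0 < q i) {x : ℝ} (hx : 0 < x) :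
    0 < restLaw q k (Set.Iio x) := by
  have hexp : IsProbabilityMeasure (expMeasure 1) := isProbabilityMeasure_expMeasure one_pos
  rw [restLaw, Measure.map_apply (by fun_prop) measurableSet_Iio]
  set Q := ∑ i ∈ univ.erase k, q i with hQ
  have hQ0 : 0 ≤ Q := sum_nonneg fun i _ => (hq i).le
  have hδ : 0 < x / (Q + 1) := by positivity
  have hbox : 0 < expLaw t (Set.univ.pi fun _ => Set.Iio (x / (Q + 1))) := by
    rw [expLaw, Measure.pi_pi]
    exact CanonicallyOrderedAdd.prod_pos.2 fun i _ => expMeasure_Iio_pos hδ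
  refine hbox.trans_le (measure_mono fun v hv => ?_)
  have hv' : ∀ i, v i < x / (Q + 1) := fun i => hv i (Set.mem_univ i)
  calc ∑ i ∈ univ.erase k, q i * v i ≤ ∑ i ∈ univ.erase k, q i * (x / (Q + 1)) :=
        sum_le_sum fun i _ => mul_le_mul_of_nonneg_left (hv' i).le (hq i).le
    _ = Q * (x / (Q + 1)) := by rw [← sum_mul]
    _ < (Q + 1) * (x / (Q + 1)) := by gcongr; linarith
    _ = x := by field_simp

end restLaw

lemma map_expLawExt2_eq_conv {t : ℕ} (q : Fin t → ℝ) (k l : Fin t) (hk : 0 < q k)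
    (hl : 0 < q l) :
    Measure.map (fun p : (Fin t → ℝ) × ℝ × ℝ =>
        (∑ i, q i * p.1 i) + q k * p.2.1 + q l * p.2.2) (expLawExt2 t) =
      Measure.conv ((expLaw t).map fun v => ∑ i, q i * v i)
        (Measure.conv (expMeasure (q k)⁻¹) (expMeasure (q l)⁻¹)) := by
  have hexp : IsProbabilityMeasure (expMeasure 1) := isProbabilityMeasure_expMeasure one_pos
  have h : Measure.conv (expMeasure (q k)⁻¹) (expMeasure (q l)⁻¹) =
      ((expMeasure 1).prod (expMeasure 1)).map fun p => q k * p.1 + q l * p.2 := by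
    rw [← map_const_mul_expMeasure hk, ← map_const_mul_expMeasure hl, Measure.conv,
      Measure.map_prod_map _ _ (by fun_prop) (by fun_prop),
      Measure.map_map (by fun_prop) (by fun_prop)]
    rfl
  rw [h, expLawExt2, Measure.conv, Measure.map_prod_map _ _ (by fun_prop) (by fun_prop),
    Measure.map_map (by fun_prop) (by fun_prop)]
  congr 1
  ext p
  simp [add_assoc]

lemma ofReal_eq_of_withDensity_eq {f g : ℝ → ℝ} (hf : Continuous f) (hg : Continuous g)
    (h : volume.withDensity (fun y => ENNReal.ofReal (f y)) =
      volume.withDensity fun y => ENNReal.ofReal (g y)) (x : ℝ) :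
    ENNReal.ofReal (f x) = ENNReal.ofReal (g x) := by
  have hf' : Continuous fun y => ENNReal.ofReal (f y) := ENNReal.continuous_ofReal.comp hf
  have hg' : Continuous fun y => ENNReal.ofReal (g y) := ENNReal.continuous_ofReal.comp hg
  have hae := (withDensity_eq_iff_of_sigmaFinite hf'.aemeasurable hg'.aemeasurable).1 h
  exact congrFun ((Continuous.ae_eq_iff_eq volume hf' hg').1 hae) x

/-- If `g` is a continuous density of `ρ ∗ Exp ∗ Exp ∗ Exp` with means `a`, `a`, `b`, then it
solves the first-order differential equation of a convolution with an exponential density. -/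
lemma hasDerivAt_of_conv_eq_withDensity (ρ : Measure ℝ) [IsProbabilityMeasure ρ] {a b : ℝ}
    (ha : 0 < a) (hb : 0 < b) (hρ : ∀ y, 0 < y → 0 < ρ (Set.Iio y)) {g : ℝ → ℝ}
    (hg : Continuous g)
    (h : Measure.conv (Measure.conv (Measure.conv ρ (expMeasure a⁻¹)) (expMeasure a⁻¹))
        (expMeasure b⁻¹) = volume.withDensity fun y => ENNReal.ofReal (g y))
    {x : ℝ} (hx : 0 < x) :
    HasDerivAt g (b⁻¹ * (erlangTwoConv ρ a x - g x)) x := by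
  have hc : 0 < b⁻¹ := inv_pos.2 hb
  have hr := continuous_erlangTwoConv ρ ha
  have h0 := erlangTwoConv_nonneg ρ a
  have hC := erlangTwoConv_le ρ ha
  have hd := hasDerivAt_expConv hc hr h0 hC
  have hp : Continuous (expConv b⁻¹ (erlangTwoConv ρ a)) :=
    continuous_iff_continuousAt.2 fun y => (hd y).continuousAt
  rw [conv_expMeasure_conv_self ρ ha, withDensity_conv_expMeasure hc hr h0 hC] at h
  have heq : ∀ y, 0 < y → g y = expConv b⁻¹ (erlangTwoConv ρ a) y := by
    intro y hy
    have hpos : 0 < expConv b⁻¹ (erlangTwoConv ρ a) y :=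
      expConv_pos hc hr h0 hC hy fun z hz => erlangTwoConv_pos ρ ha (hρ z hz)
    have h1 := ofReal_eq_of_withDensity_eq hp hg h y
    have hgy : 0 < g y := by
      rw [← ENNReal.ofReal_pos, ← h1]
      exact ENNReal.ofReal_pos.2 hpos
    exact ((ENNReal.ofReal_eq_ofReal_iff hpos.le hgy.le).1 h1).symm
  rw [heq x hx]
  refine (hd x).congr_of_eventuallyEq ?_
  filter_upwards [Ioi_mem_nhds hx] with y hy
  exact heq y hy

/-- for `q ∈ (ℝ₊^*)^t`, `x > 0` and `k, l ∈ {1,…,t}`, the partial derivatives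
`∂P{⟨q,X⟩ ≤ x}/∂q_k` and `∂P{⟨q,X⟩ ≤ x}/∂q_l` are equal if and only if
`(q_k − q_l)·f'_{⟨q,X⟩ + q_k X̃₁ + q_l X̃₂}(x) = 0`, where `X̃₁, X̃₂ ~ Exp(1)` are mutually
independent and independent of `X`, and `f` (here `g`) is the continuous version of the
density. -/
theorem partialDeriv_eq_iff (t : ℕ) (q : Fin t → ℝ) (hq : ∀ i, 0 < q i)
    (x : ℝ) (hx : 0 < x) (k l : Fin t)
    (g : ℝ → ℝ) (hg_cont : Continuous g)
    (hg_density :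
      Measure.map (fun p : (Fin t → ℝ) × ℝ × ℝ =>
          (∑ i, q i * p.1 i) + q k * p.2.1 + q l * p.2.2) (expLawExt2 t) =
        MeasureTheory.volume.withDensity fun y => ENNReal.ofReal (g y)) :
    deriv (fun s : ℝ => outage t x (Function.update q k s)) (q k) =
        deriv (fun s : ℝ => outage t x (Function.update q l s)) (q l) ↔
      (q k - q l) * deriv g x = 0 := by
  have hexp : ∀ i, IsProbabilityMeasure (expMeasure (q i)⁻¹) := fun i =>
    isProbabilityMeasure_expMeasure (inv_pos.2 (hq i))
  have h := map_expLawExt2_eq_conv q k l (hq k) (hq l)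
  rw [hg_density] at h
  have hk := hasDerivAt_of_conv_eq_withDensity (restLaw q k) (hq k) (hq l)
    (fun y hy => restLaw_Iio_pos q k hq hy) hg_cont
    (by rw [h, map_sum_eq_conv q k (hq k), Measure.conv_assoc (Measure.conv _ _)]) hx
  have hl := hasDerivAt_of_conv_eq_withDensity (restLaw q l) (hq l) (hq k)
    (fun y hy => restLaw_Iio_pos q l hq hy) hg_cont
    (by rw [h, map_sum_eq_conv q l (hq l), Measure.conv_assoc (Measure.conv _ _),
      Measure.conv_comm (expMeasure (q l)⁻¹)]) hx
  have hk0 := (hq k).ne'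
  have hl0 := (hq l).ne'
  have ek : erlangTwoConv (restLaw q k) (q k) x = g x + q l * deriv g x := by
    rw [hk.deriv]
    field_simp
    ring
  have el : erlangTwoConv (restLaw q l) (q l) x = g x + q k * deriv g x := by
    rw [hl.deriv]
    field_simp
    ring
  rw [deriv_outage_update q k (hq k), deriv_outage_update q l (hq l), ek, el]
  constructor <;> intro h <;> linarith
end

section
/- For every x > 0, if q* ∈ Θ(t) has (up to permutation) the form q* = (p_1,…,p_1, p_2,…,p_2, 0,…,0) with p_1 appearing k ≥ 2 times, p_2 appearing l ≥ 1 times, and 0 < p_1 < p_2, then q* is not a minimizer of q ↦ P{⟨q,X⟩ ≤ x} over Θ(t). That is, the smallest nonzero value of a minimizer with two distinct nonzero values appears exactly once. -/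
open MeasureTheory ProbabilityTheory Finset

/-- The simplex `Θ(t) = {q ∈ ℝ₊^t : ∑ q_i = 1}`. -/
def simplexEq (t : ℕ) : Set (Fin t → ℝ) :=
  {q | (∀ i, 0 ≤ q i) ∧ ∑ i, q i = 1}

instance expMeasure_one_isProbabilityMeasure : IsProbabilityMeasure (expMeasure 1) :=
  isProbabilityMeasure_expMeasure one_pos

/-- Bounded measurable real functions. -/
def boundedMeasurable : Submodule ℝ (ℝ → ℝ) where
  carrier := {g | Measurable g ∧ ∃ C, ∀ x, |g x| ≤ C}
  add_mem' := by
    rintro f g ⟨hf, C, hC⟩ ⟨hg, D, hD⟩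
    exact ⟨hf.add hg, C + D, fun x => (abs_add_le _ _).trans (add_le_add (hC x) (hD x))⟩
  zero_mem' := ⟨measurable_const, 0, fun x => by simp⟩
  smul_mem' := by
    rintro c f ⟨hf, C, hC⟩
    refine ⟨hf.const_smul c, |c| * C, fun x => ?_⟩
    simp only [Pi.smul_apply, smul_eq_mul, abs_mul]
    exact mul_le_mul_of_nonneg_left (hC x) (abs_nonneg c)

theorem integrable_comp_of_mem {α : Type*} [MeasurableSpace α] {μ : Measure α}
    [IsFiniteMeasure μ] {g : ℝ → ℝ} (hg : g ∈ boundedMeasurable) {f : α → ℝ}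
    (hf : Measurable f) : Integrable (fun y => g (f y)) μ := by
  obtain ⟨hm, C, hC⟩ := hg
  exact Integrable.of_bound (hm.comp hf).aestronglyMeasurable C
    (Filter.Eventually.of_forall fun y => hC _)

theorem abs_integral_comp_le {μ : Measure ℝ} [IsProbabilityMeasure μ] {g : ℝ → ℝ} {C : ℝ}
    (hC : ∀ x, |g x| ≤ C) (f : ℝ → ℝ) : |∫ y, g (f y) ∂μ| ≤ C := by
  have h : ∀ᵐ y ∂μ, ‖g (f y)‖ ≤ C := Filter.Eventually.of_forall fun y => hC (f y)
  simpa using norm_integral_le_of_norm_le_const h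

/-- The operator sending `g` to `x ↦ 𝔼[g (x - p X)]` with `X` of law `Exp(1)`. -/
noncomputable def expAverage (p : ℝ) : boundedMeasurable →ₗ[ℝ] boundedMeasurable where
  toFun g := ⟨fun x => ∫ y, (g : ℝ → ℝ) (x - p * y) ∂expMeasure 1, by
    obtain ⟨g, hg, C, hC⟩ := g
    refine ⟨?_, C, fun x => abs_integral_comp_le hC _⟩
    have : Measurable fun z : ℝ × ℝ => g (z.1 - p * z.2) := hg.comp (by fun_prop)
    exact this.stronglyMeasurable.integral_prod_right'.measurable⟩
  map_add' f g := by
    ext x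
    exact integral_add (integrable_comp_of_mem f.2 (by fun_prop))
      (integrable_comp_of_mem g.2 (by fun_prop))
  map_smul' c f := by
    ext x
    exact integral_const_mul c _

theorem expAverage_apply (p : ℝ) (g : boundedMeasurable) (x : ℝ) :
    (expAverage p g : ℝ → ℝ) x = ∫ y, (g : ℝ → ℝ) (x - p * y) ∂expMeasure 1 := rfl

theorem expAverage_comm (a b : ℝ) :
    expAverage a * expAverage b = expAverage b * expAverage a := by
  ext g x
  simp only [Module.End.mul_apply, expAverage_apply]
  rw [integral_integral_swap]
  · simp only [sub_right_comm]
  · exact integrable_comp_of_mem g.2 (by fun_prop)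

theorem expAverage_zero : expAverage 0 = 1 := by
  ext g x
  simp [expAverage_apply]

theorem abs_expAverage_le {g : boundedMeasurable} {C : ℝ} (hC : ∀ x, |(g : ℝ → ℝ) x| ≤ C)
    (p x : ℝ) : |(expAverage p g : ℝ → ℝ) x| ≤ C :=
  abs_integral_comp_le hC _

/-- The unnormalised density of the exponential law with mean `a`. -/
noncomputable def expKernel (a : ℝ) : ℝ → ℝ :=
  (Set.Ioi 0).indicator fun z => Real.exp (-z / a)

theorem integrable_expKernel {a : ℝ} (ha : 0 < a) : Integrable (expKernel a) := by
  rw [expKernel, integrable_indicator_iff measurableSet_Ioi]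
  have := exp_neg_integrableOn_Ioi 0 (inv_pos.2 ha)
  refine this.congr_fun (fun z _ => ?_) measurableSet_Ioi
  simp only
  congr 1
  field_simp

theorem integral_expMeasure_one (f : ℝ → ℝ) :
    ∫ y, f y ∂expMeasure 1 = ∫ y in Set.Ioi 0, f y * Real.exp (-y) := by
  have hm : Measurable (gammaPDF 1 1) := (measurable_gammaPDFReal 1 1).ennreal_ofReal
  rw [expMeasure, gammaMeasure, integral_withDensity_eq_integral_toReal_smul hm
      (by simp [gammaPDF]),
    ← integral_Ici_eq_integral_Ioi, ← integral_indicator measurableSet_Ici]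
  congr 1 with y
  have := exponentialPDF_eq 1 y
  rw [exponentialPDF, exponentialPDFReal] at this
  rw [gammaPDF, this]
  by_cases hy : 0 ≤ y
  · simp [Set.indicator, hy, (Real.exp_pos _).le, mul_comm]
  · simp [Set.indicator, hy]

theorem expAverage_eq_integral_expKernel {p : ℝ} (hp : 0 < p) (g : boundedMeasurable) (x : ℝ) :
    (expAverage p g : ℝ → ℝ) x = p⁻¹ * ∫ z, (g : ℝ → ℝ) (x - z) * expKernel p z := by
  rw [expAverage_apply, integral_expMeasure_one]
  have h := integral_comp_mul_left_Ioi
    (fun z => (g : ℝ → ℝ) (x - z) * Real.exp (-z / p)) 0 hp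
  have h' : ∀ y, -(p * y) / p = -y := fun y => by field_simp
  simp only [h', mul_zero, smul_eq_mul] at h
  rw [h, ← integral_indicator measurableSet_Ioi]
  congr 2 with z
  by_cases hz : 0 < z <;> simp [expKernel, Set.indicator, hz]

theorem integral_expKernel_mul_expKernel {a b : ℝ} (ha : 0 < a) (hb : 0 < b) (u : ℝ) :
    (a - b) * ∫ z, expKernel a z * expKernel b (u - z) =
      a * b * (expKernel a u - expKernel b u) := by
  by_cases hu : 0 < u
  · have h1 : ∫ z, expKernel a z * expKernel b (u - z) =
        ∫ z in (0 : ℝ)..u, Real.exp (-u / b) * Real.exp ((b⁻¹ - a⁻¹) * z) := by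
      rw [intervalIntegral.integral_of_le hu.le, integral_Ioc_eq_integral_Ioo,
        ← integral_indicator measurableSet_Ioo]
      congr 1 with z
      by_cases h0 : 0 < z <;> by_cases h1 : z < u <;> simp [expKernel, Set.indicator, h0, h1]
      rw [← Real.exp_add, ← Real.exp_add]
      congr 1
      field_simp
      ring
    have h2 := intervalIntegral.mul_integral_comp_mul_left (a := 0) (b := u)
      (f := Real.exp) (c := b⁻¹ - a⁻¹)
    rw [integral_exp, mul_zero, Real.exp_zero] at h2
    have h3 : a - b = a * b * (b⁻¹ - a⁻¹) := by field_simp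
    have h4 : Real.exp (-u / b) * Real.exp ((b⁻¹ - a⁻¹) * u) = Real.exp (-u / a) := by
      rw [← Real.exp_add]
      congr 1
      field_simp
      ring
    rw [h1, intervalIntegral.integral_const_mul, h3, mul_assoc (a * b),
      mul_left_comm _ (Real.exp _), h2, mul_sub, h4]
    simp [expKernel, Set.indicator, hu]
  · have h1 : ∀ z, expKernel a z * expKernel b (u - z) = 0 := by
      intro z
      by_cases h0 : 0 < z
      · have : ¬ z < u := by linarith
        simp [expKernel, Set.indicator, this]
      · simp [expKernel, Set.indicator, h0]
    simp only [h1]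
    simp [expKernel, Set.indicator, hu]

theorem expAverage_resolvent {a b : ℝ} (ha : 0 < a) (hb : 0 < b) :
    a • expAverage a - b • expAverage b = (a - b) • (expAverage a * expAverage b) := by
  ext g x
  have key : (expAverage a (expAverage b g) : ℝ → ℝ) x = a⁻¹ * b⁻¹ *
      ∫ u, (g : ℝ → ℝ) (x - u) * ∫ z, expKernel a z * expKernel b (u - z) := by
    obtain ⟨hg, C, hC⟩ := g.2
    have hint : Integrable (fun p : ℝ × ℝ => (g : ℝ → ℝ) (x - p.1) *
        (expKernel a p.2 * expKernel b (p.1 - p.2))) (volume.prod volume) := by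
      refine Integrable.bdd_mul (c := C) ?_
        (hg.comp (by fun_prop : Measurable fun p : ℝ × ℝ => x - p.1)).aestronglyMeasurable
        (Filter.Eventually.of_forall fun p => hC _)
      exact (integrable_expKernel ha).convolution_integrand (ContinuousLinearMap.mul ℝ ℝ)
        (integrable_expKernel hb)
    rw [expAverage_eq_integral_expKernel ha, mul_assoc]
    congr 1
    simp only [← integral_const_mul]
    rw [integral_integral_swap (hint.const_mul b⁻¹)]
    congr 1 with z
    rw [expAverage_eq_integral_expKernel hb, ← integral_const_mul, ← integral_mul_const]
    rw [← integral_sub_right_eq_self _ z]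
    congr 1 with u
    rw [sub_sub, add_sub_cancel]
    ring
  have hi : ∀ c, 0 < c → Integrable fun z => (g : ℝ → ℝ) (x - z) * expKernel c z := by
    intro c hc
    obtain ⟨hg, C, hC⟩ := g.2
    exact (integrable_expKernel hc).bdd_mul (c := C)
      (hg.comp (by fun_prop : Measurable fun z : ℝ => x - z)).aestronglyMeasurable
      (Filter.Eventually.of_forall fun p => hC _)
  change a * (expAverage a g : ℝ → ℝ) x - b * (expAverage b g : ℝ → ℝ) x =
    (a - b) * (expAverage a (expAverage b g) : ℝ → ℝ) x
  rw [key, expAverage_eq_integral_expKernel ha, expAverage_eq_integral_expKernel hb,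
    mul_inv_cancel_left₀ ha.ne', mul_inv_cancel_left₀ hb.ne', ← integral_sub (hi a ha) (hi b hb),
    mul_left_comm, ← integral_const_mul, ← integral_const_mul]
  congr 1 with u
  rw [mul_left_comm (a - b), integral_expKernel_mul_expKernel ha hb]
  field_simp

theorem expAverage_eq_intervalIntegral {p : ℝ} (hp : 0 < p) {g : boundedMeasurable}
    (h0 : ∀ x < 0, (g : ℝ → ℝ) x = 0) {x : ℝ} (hx : 0 ≤ x) :
    (expAverage p g : ℝ → ℝ) x =
      p⁻¹ * (Real.exp (-x / p) * ∫ z in (0 : ℝ)..x, (g : ℝ → ℝ) z * Real.exp (z / p)) := by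
  rw [expAverage_eq_integral_expKernel hp, ← integral_sub_left_eq_self _ _ x,
    intervalIntegral.integral_of_le hx, ← integral_Ico_eq_integral_Ioc,
    ← integral_const_mul (Real.exp (-x / p)), ← integral_indicator measurableSet_Ico]
  congr 2 with z
  rw [sub_sub_cancel]
  by_cases hz : 0 ≤ z
  · by_cases hzx : z < x
    · have : Real.exp (-(x - z) / p) = Real.exp (-x / p) * Real.exp (z / p) := by
        rw [← Real.exp_add]
        congr 1
        ring
      simp only [expKernel, Set.indicator, Set.mem_Ioi, sub_pos, hzx, if_true, Set.mem_Ico, hz,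
        and_self, this]
      ring
    · simp [expKernel, Set.indicator, hzx]
  · simp [Set.indicator, hz, h0 z (not_le.1 hz)]

theorem expAverage_of_neg {p : ℝ} (hp : 0 ≤ p) {g : boundedMeasurable}
    (h0 : ∀ x < 0, (g : ℝ → ℝ) x = 0) {x : ℝ} (hx : x < 0) :
    (expAverage p g : ℝ → ℝ) x = 0 := by
  rw [expAverage_apply, integral_expMeasure_one]
  refine setIntegral_eq_zero_of_forall_eq_zero fun y hy => ?_
  rw [h0, zero_mul]
  have := mul_nonneg hp (le_of_lt hy)
  linarith

/-- A function supported on `[0, ∞)` which is first positive and then negative on `(0, ∞)`. -/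
def CrossesOnce (g : ℝ → ℝ) : Prop :=
  (∀ x < 0, g x = 0) ∧ ∀ x y, 0 < y → y < x → 0 ≤ g x → 0 < g y

theorem intervalIntegrable_mul_exp (g : boundedMeasurable) (p a b : ℝ) :
    IntervalIntegrable (fun z => (g : ℝ → ℝ) z * Real.exp (z / p)) volume a b := by
  obtain ⟨hg, C, hC⟩ := g.2
  have hi : IntervalIntegrable (fun z : ℝ => Real.exp (z / p)) volume a b :=
    (by fun_prop : Continuous fun z : ℝ => Real.exp (z / p)).intervalIntegrable _ _
  rw [intervalIntegrable_iff] at hi ⊢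
  exact hi.bdd_mul (c := C) hg.aestronglyMeasurable (Filter.Eventually.of_forall fun p => hC _)

theorem expAverage_pos {p : ℝ} (hp : 0 < p) {g : boundedMeasurable}
    (h0 : ∀ x < 0, (g : ℝ → ℝ) x = 0) {x : ℝ} (hx : 0 < x)
    (hg : ∀ y, 0 < y → y < x → 0 < (g : ℝ → ℝ) y) : 0 < (expAverage p g : ℝ → ℝ) x := by
  rw [expAverage_eq_intervalIntegral hp h0 hx.le]
  have := intervalIntegral.intervalIntegral_pos_of_pos_on
    (intervalIntegrable_mul_exp g p 0 x) (fun z hz => by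
      have := hg z hz.1 hz.2
      positivity) hx
  positivity

theorem CrossesOnce.expAverage {p : ℝ} (hp : 0 ≤ p) {g : boundedMeasurable}
    (hg : CrossesOnce g) : CrossesOnce (expAverage p g) := by
  rcases hp.eq_or_lt with rfl | hp
  · rwa [expAverage_zero]
  refine ⟨fun x hx => expAverage_of_neg hp.le hg.1 hx, fun x y hy hyx hx => ?_⟩
  by_cases h : ∃ z, y < z ∧ z < x ∧ 0 ≤ (g : ℝ → ℝ) z
  · obtain ⟨z, hyz, -, hz⟩ := h
    exact expAverage_pos hp hg.1 hy fun w hw hwy => hg.2 z w hw (hwy.trans hyz) hz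
  · push Not at h
    rw [expAverage_eq_intervalIntegral hp hg.1 (hy.trans hyx).le] at hx
    rw [expAverage_eq_intervalIntegral hp hg.1 hy.le]
    have hpos := intervalIntegral.intervalIntegral_pos_of_pos_on
      (intervalIntegrable_mul_exp g p y x).neg (fun z hz => by
        have := h z hz.1 hz.2
        have := mul_pos (neg_pos.2 this) (Real.exp_pos (z / p))
        simpa using this) hyx
    simp only [Pi.neg_apply, intervalIntegral.integral_neg] at hpos
    have hadd := intervalIntegral.integral_add_adjacent_intervals
      (intervalIntegrable_mul_exp g p 0 y) (intervalIntegrable_mul_exp g p y x)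
    have hx' := nonneg_of_mul_nonneg_right (nonneg_of_mul_nonneg_right hx (inv_pos.2 hp))
      (Real.exp_pos _)
    have : 0 < ∫ z in (0 : ℝ)..y, (g : ℝ → ℝ) z * Real.exp (z / p) := by linarith
    positivity

/-- The distribution function of the Dirac mass at `0`. -/
noncomputable def unitStep : boundedMeasurable :=
  ⟨(Set.Ici 0).indicator 1, measurable_one.indicator measurableSet_Ici, 1, fun x => by
    by_cases hx : 0 ≤ x <;> simp [Set.indicator, hx]⟩

theorem unitStep_apply (x : ℝ) : (unitStep : ℝ → ℝ) x = (Set.Ici (0 : ℝ)).indicator 1 x := rfl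

theorem unitStep_of_nonneg {x : ℝ} (hx : 0 ≤ x) : (unitStep : ℝ → ℝ) x = 1 := by
  simp [unitStep_apply, Set.indicator, hx]

theorem unitStep_of_neg {x : ℝ} (hx : x < 0) : (unitStep : ℝ → ℝ) x = 0 := by
  simp [unitStep_apply, Set.indicator, hx]

theorem expAverage_unitStep {p : ℝ} (hp : 0 < p) {x : ℝ} (hx : 0 ≤ x) :
    (expAverage p unitStep : ℝ → ℝ) x = 1 - Real.exp (-x / p) := by
  have h1 : ∫ z in (0 : ℝ)..x, (unitStep : ℝ → ℝ) z * Real.exp (z / p) =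
      ∫ z in (0 : ℝ)..x, Real.exp (z / p) := by
    refine intervalIntegral.integral_congr fun z hz => ?_
    rw [Set.uIcc_of_le hx] at hz
    simp only [unitStep_of_nonneg hz.1, one_mul]
  have h2 := intervalIntegral.inv_mul_integral_comp_div (a := 0) (b := x) (f := Real.exp) (c := p)
  rw [integral_exp, zero_div, Real.exp_zero] at h2
  rw [expAverage_eq_intervalIntegral hp (fun _ => unitStep_of_neg) hx, h1, mul_left_comm, h2,
    mul_sub, ← Real.exp_add]
  simp [neg_div]

theorem crossesOnce_gamma_two {p : ℝ} (hp : 0 < p) :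
    CrossesOnce (((1 - expAverage p) * (1 - expAverage p)) unitStep : boundedMeasurable) := by
  set g : boundedMeasurable := (1 - expAverage p) unitStep with hg
  have hg_apply : ∀ x, (g : ℝ → ℝ) x =
      (unitStep : ℝ → ℝ) x - (expAverage p unitStep : ℝ → ℝ) x := fun x => rfl
  have hneg : ∀ x < 0, (g : ℝ → ℝ) x = 0 := fun x hx => by
    rw [hg_apply, unitStep_of_neg hx, expAverage_of_neg hp.le (fun _ => unitStep_of_neg) hx,
      sub_zero]
  have hnonneg : ∀ x, 0 ≤ x → (g : ℝ → ℝ) x = Real.exp (-x / p) := fun x hx => by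
    rw [hg_apply, unitStep_of_nonneg hx, expAverage_unitStep hp hx, sub_sub_cancel]
  have happly : ∀ x, ((((1 - expAverage p) * (1 - expAverage p)) unitStep : boundedMeasurable) :
      ℝ → ℝ) x = (g : ℝ → ℝ) x - (expAverage p g : ℝ → ℝ) x := fun x => rfl
  have hformula : ∀ x, 0 ≤ x →
      ((((1 - expAverage p) * (1 - expAverage p)) unitStep : boundedMeasurable) : ℝ → ℝ) x =
        Real.exp (-x / p) * (1 - x / p) := fun x hx => by
    have h1 : ∫ z in (0 : ℝ)..x, (g : ℝ → ℝ) z * Real.exp (z / p) = ∫ z in (0 : ℝ)..x, 1 := by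
      refine intervalIntegral.integral_congr fun z hz => ?_
      rw [Set.uIcc_of_le hx] at hz
      simp only [hnonneg z hz.1, ← Real.exp_add, neg_div, neg_add_cancel, Real.exp_zero]
    rw [happly, expAverage_eq_intervalIntegral hp hneg hx, h1, hnonneg x hx]
    simp
    ring
  refine ⟨fun x hx => ?_, fun x y hy hyx hx => ?_⟩
  · rw [happly, hneg x hx, expAverage_of_neg hp.le hneg hx, sub_zero]
  · rw [hformula x (hy.trans hyx).le] at hx
    rw [hformula y hy.le]
    have h1 := nonneg_of_mul_nonneg_right hx (Real.exp_pos _)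
    have h2 : y / p < x / p := by gcongr
    exact mul_pos (Real.exp_pos _) (by linarith)

open scoped IsMulCommutative in
/-- The commutative ring structure on the algebra generated by commuting endomorphisms. -/
@[reducible]
noncomputable def adjoinRangeCommRing {ι V : Type*} [AddCommGroup V] [Module ℝ V]
    (T : ι → Module.End ℝ V) (hT : ∀ a b, T a * T b = T b * T a) :
    CommRing (Algebra.adjoin ℝ (Set.range T)) :=
  haveI : IsMulCommutative (Algebra.adjoin ℝ (Set.range T)) :=
    Algebra.isMulCommutative_adjoin ℝ (by
      rintro _ ⟨a, rfl⟩ _ ⟨b, rfl⟩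
      exact hT a b)
  inferInstance

/-- The commutative algebra of operators generated by the exponential averages. -/
def ExpAlgebra : Type :=
  Algebra.adjoin ℝ (Set.range expAverage)

noncomputable instance expAlgebraCommRing : CommRing ExpAlgebra :=
  adjoinRangeCommRing expAverage expAverage_comm

noncomputable instance expAlgebraAlgebra : Algebra ℝ ExpAlgebra :=
  (Algebra.adjoin ℝ (Set.range expAverage)).algebra

/-- The inclusion of `ExpAlgebra` in the algebra of all operators. -/
noncomputable def ExpAlgebra.val : ExpAlgebra →ₐ[ℝ] Module.End ℝ boundedMeasurable :=
  (Algebra.adjoin ℝ (Set.range expAverage)).val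

theorem ExpAlgebra.val_injective : Function.Injective ExpAlgebra.val :=
  Subtype.val_injective

/-- The exponential average as an element of the commutative algebra `ExpAlgebra`. -/
noncomputable def expOp (p : ℝ) : ExpAlgebra :=
  ⟨expAverage p, Algebra.subset_adjoin ⟨p, rfl⟩⟩

theorem ExpAlgebra.val_expOp (p : ℝ) : ExpAlgebra.val (expOp p) = expAverage p := rfl

/-- The value at `x` of an operator of `ExpAlgebra` applied to the unit step. -/
noncomputable def stepValue (x : ℝ) : ExpAlgebra →ₗ[ℝ] ℝ where
  toFun A := ((ExpAlgebra.val A unitStep : boundedMeasurable) : ℝ → ℝ) x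
  map_add' A B := by
    rw [map_add]
    rfl
  map_smul' c A := by
    rw [map_smul]
    rfl

theorem stepValue_apply (x : ℝ) (A : ExpAlgebra) :
    stepValue x A = (ExpAlgebra.val A unitStep : ℝ → ℝ) x := rfl

theorem expOp_resolvent {a b : ℝ} (ha : 0 < a) (hb : 0 < b) :
    algebraMap ℝ ExpAlgebra a * expOp a - algebraMap ℝ ExpAlgebra b * expOp b =
      (algebraMap ℝ ExpAlgebra a - algebraMap ℝ ExpAlgebra b) * (expOp a * expOp b) := by
  rw [← map_sub, ← Algebra.smul_def, ← Algebra.smul_def, ← Algebra.smul_def]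
  apply ExpAlgebra.val_injective
  simpa only [map_sub, map_smul, map_mul, ExpAlgebra.val_expOp] using expAverage_resolvent ha hb

theorem expOp_perturb {a b e : ℝ} (ha : 0 < a) (hb : 0 < b) (hae : 0 < a + e) (hbe : 0 < b - e)
    (he : e ≠ 0) :
    algebraMap ℝ ExpAlgebra (e * (b - a - e)) *
        ((1 - expOp a) * (1 - expOp b) * (expOp (a + e) * expOp (b - e))) =
      algebraMap ℝ ExpAlgebra (a * b) *
        (expOp a * expOp b - expOp (a + e) * expOp (b - e)) := by
  have h1 := expOp_resolvent ha hae
  have h2 := expOp_resolvent hb hbe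
  have h3 := expOp_resolvent ha hb
  have h4 := expOp_resolvent hae hbe
  have h5 := expOp_resolvent ha hbe
  have h6 := expOp_resolvent hae hb
  have h7 : algebraMap ℝ ExpAlgebra e * algebraMap ℝ ExpAlgebra e⁻¹ = 1 := by
    rw [← map_mul, mul_inv_cancel₀ he, map_one]
  simp only [map_mul, map_sub, map_add] at *
  generalize expOp a = A at *
  generalize expOp b = B at *
  generalize expOp (a + e) = A' at *
  generalize expOp (b - e) = B' at *
  generalize algebraMap ℝ ExpAlgebra a = α at *
  generalize algebraMap ℝ ExpAlgebra b = β at *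
  generalize algebraMap ℝ ExpAlgebra e = ε at *
  generalize algebraMap ℝ ExpAlgebra e⁻¹ = ι at *
  have k1 : ε * ((1 - A) * A') = α * (A - A') := by linear_combination -h1
  have k2 : ε * ((1 - B) * B') = β * (B' - B) := by linear_combination h2
  have k3 : (β - α - ε) * ((A - A') * (B' - B)) = ε * (A * B - A' * B') := by
    linear_combination h5 + h6 - h3 - h4
  have k4 : ε * ε * ((β - α - ε) * ((1 - A) * (1 - B) * (A' * B'))) =
      ε * (α * β * (A * B - A' * B')) := by
    linear_combination (β - α - ε) * (ε * ((1 - B) * B') * k1 + α * (A - A') * k2) + α * β * k3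
  linear_combination ι * k4 + (α * β * (A * B - A' * B') -
    ε * ((β - α - ε) * ((1 - A) * (1 - B) * (A' * B')))) * h7

theorem stepValue_expOp_mul (x p : ℝ) (A : ExpAlgebra) :
    stepValue x (expOp p * A) = ∫ y, stepValue (x - p * y) A ∂expMeasure 1 := by
  simp only [stepValue_apply, map_mul, ExpAlgebra.val_expOp, Module.End.mul_apply,
    expAverage_apply]

theorem outage_eq_stepValue (t : ℕ) (x : ℝ) (q : Fin t → ℝ) :
    outage t x q = stepValue x (∏ i, expOp (q i)) := by
  induction t generalizing x with
  | zero =>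
    rw [outage, expLaw, Measure.pi_of_empty, stepValue_apply]
    by_cases hx : 0 ≤ x
    · simp [unitStep_of_nonneg hx, hx]
    · simp [unitStep_of_neg (not_le.1 hx), hx]
  | succ t ih =>
    rw [Fin.prod_univ_succ, stepValue_expOp_mul]
    have ih' : ∀ y, stepValue y (∏ i : Fin t, expOp (q i.succ)) =
        outage t y fun i => q i.succ := fun y => (ih y _).symm
    simp only [ih']
    have hmp := measurePreserving_piFinSuccAbove
      (fun _ : Fin (t + 1) => expMeasure 1) 0
    have hS : MeasurableSet {z : ℝ × (Fin t → ℝ) | q 0 * z.1 + ∑ i, q i.succ * z.2 i ≤ x} :=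
      measurableSet_le (by fun_prop) (by fun_prop)
    have hpre : {v : Fin (t + 1) → ℝ | ∑ i, q i * v i ≤ x} =
        MeasurableEquiv.piFinSuccAbove (fun _ => ℝ) 0 ⁻¹'
          {z : ℝ × (Fin t → ℝ) | q 0 * z.1 + ∑ i, q i.succ * z.2 i ≤ x} := by
      ext v
      simp [Fin.sum_univ_succ, MeasurableEquiv.piFinSuccAbove, Fin.insertNthEquiv, Fin.tail]
    have hsec : ∀ y : ℝ, Prod.mk y ⁻¹'
        {z : ℝ × (Fin t → ℝ) | q 0 * z.1 + ∑ i, q i.succ * z.2 i ≤ x} =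
        {v | ∑ i, q i.succ * v i ≤ x - q 0 * y} := by
      intro y
      ext v
      simp [le_sub_iff_add_le']
    have := measurable_measure_prodMk_left (ν := Measure.pi fun _ : Fin t => expMeasure 1) hS
    rw [outage, expLaw, hpre, hmp.measure_preimage hS.nullMeasurableSet, Measure.prod_apply hS,
      ← integral_toReal this.aemeasurable (Filter.Eventually.of_forall fun y => measure_lt_top _ _)]
    simp only [hsec]
    rfl

theorem exists_bound_expOp_mul (A : ExpAlgebra) (x : ℝ) :
    ∃ C, ∀ a b, |stepValue x (expOp a * expOp b * A)| ≤ C := by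
  obtain ⟨-, C, hC⟩ := (ExpAlgebra.val A unitStep).2
  refine ⟨C, fun a b => ?_⟩
  simp only [stepValue_apply, map_mul, ExpAlgebra.val_expOp, Module.End.mul_apply]
  exact abs_expAverage_le (abs_expAverage_le hC b) a x

theorem stepValue_algebraMap_mul (x c : ℝ) (A : ExpAlgebra) :
    stepValue x (algebraMap ℝ ExpAlgebra c * A) = c * stepValue x A := by
  rw [← Algebra.smul_def, map_smul, smul_eq_mul]

theorem stepValue_perturb {a b e : ℝ} (ha : 0 < a) (hb : 0 < b) (hae : 0 < a + e)
    (hbe : 0 < b - e) (he : e ≠ 0) (A : ExpAlgebra) (x : ℝ) :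
    stepValue x (expOp a * expOp b * A) - stepValue x (expOp (a + e) * expOp (b - e) * A) =
      e * (b - a - e) / (a * b) *
        (stepValue x (expOp a * expOp b * ((1 - expOp a) * (1 - expOp b) * A)) -
          e * (b - a - e) / (a * b) * stepValue x (expOp (a + e) * expOp (b - e) *
            ((1 - expOp a) * (1 - expOp b) * ((1 - expOp a) * (1 - expOp b) * A)))) := by
  have h := expOp_perturb ha hb hae hbe he
  have hab : a * b ≠ 0 := by positivity
  set δ := e * (b - a - e)
  have h1 := congrArg (fun B => stepValue x (B * A)) h
  have h2 := congrArg (fun B => stepValue x (B * ((1 - expOp a) * (1 - expOp b) * A))) h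
  simp only [mul_assoc (algebraMap _ _ _), stepValue_algebraMap_mul, sub_mul _ _ A,
    sub_mul _ _ ((1 - expOp a) * (1 - expOp b) * A), map_sub (stepValue x)] at h1 h2
  rw [show (1 - expOp a) * (1 - expOp b) * (expOp (a + e) * expOp (b - e)) * A =
    expOp (a + e) * expOp (b - e) * ((1 - expOp a) * (1 - expOp b) * A) by ring] at h1
  rw [show (1 - expOp a) * (1 - expOp b) * (expOp (a + e) * expOp (b - e)) *
      ((1 - expOp a) * (1 - expOp b) * A) = expOp (a + e) * expOp (b - e) *
      ((1 - expOp a) * (1 - expOp b) * ((1 - expOp a) * (1 - expOp b) * A)) by ring] at h2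
  generalize stepValue x (expOp a * expOp b * A) = u₁ at *
  generalize stepValue x (expOp (a + e) * expOp (b - e) * A) = u₂ at *
  generalize stepValue x (expOp (a + e) * expOp (b - e) *
    ((1 - expOp a) * (1 - expOp b) * A)) = u₃ at *
  generalize stepValue x (expOp a * expOp b * ((1 - expOp a) * (1 - expOp b) * A)) = u₄ at *
  generalize stepValue x (expOp (a + e) * expOp (b - e) *
    ((1 - expOp a) * (1 - expOp b) * ((1 - expOp a) * (1 - expOp b) * A))) = u₅ at *
  field_simp
  linear_combination -a * b * h1 + δ * h2

theorem exists_stepValue_lt {a b : ℝ} (ha : 0 < a) (hab : a ≤ b) (A : ExpAlgebra) (x : ℝ)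
    (hne : stepValue x (expOp a * expOp b * ((1 - expOp a) * (1 - expOp b) * A)) ≠ 0)
    (hpos : 0 < stepValue x (expOp a * expOp b * ((1 - expOp a) * (1 - expOp b) * A)) → a < b) :
    ∃ e, 0 ≤ a + e ∧ 0 ≤ b - e ∧
      stepValue x (expOp (a + e) * expOp (b - e) * A) < stepValue x (expOp a * expOp b * A) := by
  have hb : 0 < b := ha.trans_le hab
  obtain ⟨C, hC⟩ := exists_bound_expOp_mul
    ((1 - expOp a) * (1 - expOp b) * ((1 - expOp a) * (1 - expOp b) * A)) x
  set N := stepValue x (expOp a * expOp b * ((1 - expOp a) * (1 - expOp b) * A)) with hN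
  set κ : ℝ → ℝ := fun e => e * (b - a - e) / (a * b) with hκ
  have hκ0 : κ 0 = 0 := by simp [hκ]
  have hlim : Filter.Tendsto κ (nhds 0) (nhds 0) := by
    have : Continuous κ := by fun_prop
    simpa only [hκ0] using this.tendsto 0
  have hsmall : ∀ᶠ e in nhds 0, |κ e| * C < |N| := by
    have h1 : Filter.Tendsto (fun e => |κ e| * C) (nhds 0) (nhds 0) := by
      simpa using hlim.abs.mul_const C
    exact h1.eventually (gt_mem_nhds (abs_pos.2 hne))
  have hae : ∀ᶠ e in nhds (0 : ℝ), 0 < a + e :=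
    (by fun_prop : Continuous fun e => a + e).continuousAt.eventually (lt_mem_nhds (by simpa))
  have hbe : ∀ᶠ e in nhds (0 : ℝ), 0 < b - e :=
    (by fun_prop : Continuous fun e => b - e).continuousAt.eventually (lt_mem_nhds (by simpa))
  have hsign : ∃ᶠ e in nhds (0 : ℝ), e ≠ 0 ∧ 0 < κ e * N := by
    rcases hne.lt_or_gt with h | h
    · have : ∀ᶠ e in nhdsWithin (0 : ℝ) (Set.Iio 0), e ≠ 0 ∧ 0 < κ e * N := by
        filter_upwards [self_mem_nhdsWithin] with e he
        have he : e < 0 := he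
        refine ⟨he.ne, mul_pos_of_neg_of_neg (div_neg_of_neg_of_pos ?_ (by positivity)) h⟩
        exact mul_neg_of_neg_of_pos he (by linarith)
      exact this.frequently.filter_mono nhdsWithin_le_nhds
    · have hlt := hpos h
      have : ∀ᶠ e in nhdsWithin (0 : ℝ) (Set.Ioi 0), e ≠ 0 ∧ 0 < κ e * N := by
        filter_upwards [Ioo_mem_nhdsGT (sub_pos.2 hlt)] with e he
        refine ⟨he.1.ne', mul_pos (div_pos ?_ (by positivity)) h⟩
        exact mul_pos he.1 (by linarith [he.2])
      exact this.frequently.filter_mono nhdsWithin_le_nhds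
  obtain ⟨e, ⟨he, hκN⟩, hs, hae, hbe⟩ := (hsign.and_eventually (hsmall.and (hae.and hbe))).exists
  refine ⟨e, hae.le, hbe.le, sub_pos.1 ?_⟩
  rw [stepValue_perturb ha hb hae hbe he, ← hN]
  change 0 < κ e * (N - κ e * _)
  have hE := hC (a + e) (b - e)
  generalize stepValue x (expOp (a + e) * expOp (b - e) *
    ((1 - expOp a) * (1 - expOp b) * ((1 - expOp a) * (1 - expOp b) * A))) = E at hE ⊢
  have h1 : |κ e * E| < |N| := by
    rw [abs_mul]
    exact (mul_le_mul_of_nonneg_left hE (abs_nonneg _)).trans_lt hs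
  rcases pos_and_pos_or_neg_and_neg_of_mul_pos hκN with ⟨hk, hn⟩ | ⟨hk, hn⟩
  · rw [abs_of_pos hn] at h1
    exact mul_pos hk (by linarith [(abs_lt.1 h1).2])
  · rw [abs_of_neg hn] at h1
    exact mul_pos_of_neg_of_neg hk (by linarith [(abs_lt.1 h1).1])

theorem exists_outage_lt {t : ℕ} {x : ℝ} {q : Fin t → ℝ} (hq : q ∈ simplexEq t) {i j : Fin t}
    (hij : i ≠ j) (hi : 0 < q i) (hle : q i ≤ q j)
    (hne : stepValue x (expOp (q i) * expOp (q j) * ((1 - expOp (q i)) * (1 - expOp (q j)) *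
      ∏ m ∈ (univ.erase i).erase j, expOp (q m))) ≠ 0)
    (hpos : 0 < stepValue x (expOp (q i) * expOp (q j) * ((1 - expOp (q i)) * (1 - expOp (q j)) *
      ∏ m ∈ (univ.erase i).erase j, expOp (q m))) → q i < q j) :
    ∃ q' ∈ simplexEq t, outage t x q' < outage t x q := by
  obtain ⟨e, hie, hje, hlt⟩ := exists_stepValue_lt hi hle _ x hne hpos
  set q' : Fin t → ℝ := Function.update (Function.update q i (q i + e)) j (q j - e) with hq'
  have hi' : q' i = q i + e := by simp [hq', hij]
  have hj' : q' j = q j - e := by simp [hq']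
  have hm' : ∀ m ∈ (univ.erase i).erase j, q' m = q m := by
    intro m hm
    simp only [mem_erase] at hm
    simp [hq', hm.1, hm.2.1]
  have hj_mem : j ∈ univ.erase i := by simp [hij.symm]
  have hprod : ∀ r : Fin t → ℝ, ∏ m, expOp (r m) =
      expOp (r i) * expOp (r j) * ∏ m ∈ (univ.erase i).erase j, expOp (r m) := by
    intro r
    rw [mul_assoc, mul_prod_erase _ (fun m => expOp (r m)) hj_mem,
      mul_prod_erase _ (fun m => expOp (r m)) (mem_univ i)]
  have hsum : ∀ r : Fin t → ℝ, ∑ m, r m = r i + (r j + ∑ m ∈ (univ.erase i).erase j, r m) := by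
    intro r
    rw [add_sum_erase _ r hj_mem, add_sum_erase _ r (mem_univ i)]
  refine ⟨q', ⟨fun m => ?_, ?_⟩, ?_⟩
  · by_cases hmi : m = i
    · rw [hmi, hi']
      exact hie
    · by_cases hmj : m = j
      · rw [hmj, hj']
        exact hje
      · rw [hm' m (by simp [hmi, hmj])]
        exact hq.1 m
  · rw [← hq.2, hsum q', hsum q, hi', hj', sum_congr rfl hm']
    ring
  · rw [outage_eq_stepValue, outage_eq_stepValue, hprod q', hprod q, hi', hj',
      prod_congr rfl fun m hm => congrArg expOp (hm' m hm)]
    exact hlt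

theorem crossesOnce_prod {ι : Type*} {q : ι → ℝ} (hq : ∀ i, 0 ≤ q i) (s : Finset ι) {p : ℝ}
    (hp : 0 < p) :
    CrossesOnce fun x =>
      stepValue x ((∏ i ∈ s, expOp (q i)) * ((1 - expOp p) * (1 - expOp p))) := by
  classical
  induction s using Finset.induction_on with
  | empty =>
    simp only [prod_empty, one_mul, stepValue_apply, map_mul, map_sub, map_one,
      ExpAlgebra.val_expOp]
    exact crossesOnce_gamma_two hp
  | insert i s hi ih =>
    simp only [prod_insert hi, mul_assoc, stepValue_apply, map_mul (ExpAlgebra.val),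
      Module.End.mul_apply, ExpAlgebra.val_expOp] at ih ⊢
    exact ih.expAverage (hq i)

theorem exists_outage_lt_of_eq_of_lt {t : ℕ} {x : ℝ} (hx : 0 < x) {q : Fin t → ℝ}
    (hq : q ∈ simplexEq t) {i₀ i₁ j : Fin t} (hi : i₀ ≠ i₁) (hpos : 0 < q i₀)
    (heq : q i₀ = q i₁) (hlt : q i₀ < q j) :
    ∃ q' ∈ simplexEq t, outage t x q' < outage t x q := by
  have hj₀ : i₀ ≠ j := fun h => hlt.ne (congrArg q h)
  have hj₁ : i₁ ≠ j := fun h => hlt.ne (heq.trans (congrArg q h))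
  have hR₁ : ∏ m ∈ (univ.erase i₀).erase i₁, expOp (q m) =
      expOp (q j) * ∏ m ∈ ((univ.erase i₀).erase i₁).erase j, expOp (q m) :=
    (mul_prod_erase _ (fun m => expOp (q m)) (by simp [hj₀.symm, hj₁.symm])).symm
  have hR₂ : ∏ m ∈ (univ.erase i₀).erase j, expOp (q m) =
      expOp (q i₀) * ∏ m ∈ ((univ.erase i₀).erase i₁).erase j, expOp (q m) := by
    rw [erase_right_comm (a := i₁), heq]
    exact (mul_prod_erase _ (fun m => expOp (q m)) (by simp [hi.symm, hj₁])).symm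
  have h₁ := exists_outage_lt (x := x) hq hi hpos heq.le
  have h₂ := exists_outage_lt (x := x) hq hj₀ hpos hlt.le
  rw [hR₁, ← heq] at h₁
  rw [hR₂] at h₂
  set O := ∏ m ∈ ((univ.erase i₀).erase i₁).erase j, expOp (q m) with hO
  have hcross : CrossesOnce fun y => stepValue y (expOp (q i₀) * (expOp (q j) * (expOp (q j) *
      (O * ((1 - expOp (q i₀)) * (1 - expOp (q i₀))))))) := by
    have := crossesOnce_prod hq.1 (((univ.erase i₀).erase i₁).erase j) hpos
    rw [← hO] at this
    simp only [stepValue_apply, map_mul ExpAlgebra.val (expOp _), ExpAlgebra.val_expOp,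
      Module.End.mul_apply] at this ⊢
    exact ((this.expAverage (hq.1 j)).expAverage (hq.1 j)).expAverage (hq.1 i₀)
  set V := expOp (q i₀) * (expOp (q j) * (expOp (q j) *
      (O * ((1 - expOp (q i₀)) * (1 - expOp (q i₀)))))) with hV
  have hres := expOp_resolvent hpos (hpos.trans hlt)
  have e₂ := congrArg (stepValue x) (show algebraMap ℝ ExpAlgebra (q i₀) *
      (expOp (q i₀) * expOp (q j) * ((1 - expOp (q i₀)) * (1 - expOp (q j)) *
        (expOp (q i₀) * O))) = algebraMap ℝ ExpAlgebra (q j) * V by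
    rw [hV]
    linear_combination expOp (q i₀) * expOp (q j) * (1 - expOp (q i₀)) * O * hres)
  have e₁ := congrArg (stepValue x) (show algebraMap ℝ ExpAlgebra (q i₀) *
      (expOp (q i₀) * expOp (q i₀) * ((1 - expOp (q i₀)) * (1 - expOp (q i₀)) *
        (expOp (q j) * O))) = algebraMap ℝ ExpAlgebra (q j) * V +
          algebraMap ℝ ExpAlgebra (q i₀ - q j) * (expOp (q i₀) * V) by
    rw [hV, map_sub]
    linear_combination expOp (q i₀) * (1 - expOp (q i₀)) * (1 - expOp (q i₀)) *
      expOp (q j) * O * hres)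
  rw [stepValue_algebraMap_mul, stepValue_algebraMap_mul] at e₂
  rw [map_add, stepValue_algebraMap_mul, stepValue_algebraMap_mul, stepValue_algebraMap_mul] at e₁
  by_cases h0 : stepValue x (expOp (q i₀) * expOp (q j) * ((1 - expOp (q i₀)) *
      (1 - expOp (q j)) * (expOp (q i₀) * O))) = 0
  · rw [h0, mul_zero, zero_eq_mul, or_iff_right (hpos.trans hlt).ne'] at e₂
    rw [e₂, mul_zero, zero_add] at e₁
    have hp : 0 < stepValue x (expOp (q i₀) * V) := by
      have := expAverage_pos hpos (g := ExpAlgebra.val V unitStep) hcross.1 hx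
        fun y hy hyx => hcross.2 x y hy hyx e₂.ge
      simpa only [stepValue_apply, map_mul ExpAlgebra.val (expOp _) V, ExpAlgebra.val_expOp,
        Module.End.mul_apply] using this
    have hneg : stepValue x (expOp (q i₀) * expOp (q i₀) * ((1 - expOp (q i₀)) *
        (1 - expOp (q i₀)) * (expOp (q j) * O))) < 0 := by
      have : (q i₀ - q j) * stepValue x (expOp (q i₀) * V) < 0 :=
        mul_neg_of_neg_of_pos (sub_neg.2 hlt) hp
      rw [← e₁] at this
      exact (pos_iff_neg_of_mul_neg this).1 hpos
    exact h₁ hneg.ne fun h => absurd h hneg.not_gt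
  · exact h₂ h0 fun _ => hlt

/-- for `x > 0`, a point of `Θ(t)` of the form
`(p₁,…,p₁,p₂,…,p₂,0,…,0)` (up to permutation) with `p₁` appearing `k ≥ 2` times, `p₂`
appearing `l ≥ 1` times and `0 < p₁ < p₂` is not a minimizer of `q ↦ P{⟨q,X⟩ ≤ x}` over
`Θ(t)`: the smallest nonzero value of a minimizer with two distinct nonzero values
appears exactly once. -/
theorem smallest_value_appears_once (t : ℕ) (x : ℝ) (hx : 0 < x)
    (k l : ℕ) (hk : 2 ≤ k) (hl : 1 ≤ l) (hkl : k + l ≤ t)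
    (p₁ p₂ : ℝ) (hp₁ : 0 < p₁) (hp₁₂ : p₁ < p₂)
    (q : Fin t → ℝ) (hq_mem : q ∈ simplexEq t)
    (hform : ∃ σ : Equiv.Perm (Fin t), ∀ i : Fin t,
      q (σ i) = if (i : ℕ) < k then p₁ else if (i : ℕ) < k + l then p₂ else 0) :
    ∃ q' ∈ simplexEq t, outage t x q' < outage t x q := by
  obtain ⟨σ, hσ⟩ := hform
  have h0 : q (σ ⟨0, by omega⟩) = p₁ := by
    rw [hσ, if_pos (by simp only; omega)]
  have h1 : q (σ ⟨1, by omega⟩) = p₁ := by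
    rw [hσ, if_pos (by simp only; omega)]
  have hk' : q (σ ⟨k, by omega⟩) = p₂ := by
    rw [hσ, if_neg (by simp), if_pos (by simp only; omega)]
  refine exists_outage_lt_of_eq_of_lt hx hq_mem (i₀ := σ ⟨0, by omega⟩) (i₁ := σ ⟨1, by omega⟩)
    (j := σ ⟨k, by omega⟩) (fun h => ?_) ?_ ?_ ?_
  · simpa using σ.injective h
  · rwa [h0]
  · rw [h0, h1]
  · rwa [h0, hk']
end
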